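/- Let the points be the 2-element subsets of {1,2,…,8}, let M = {{1,2},{3,4},{5,6},{7,8}}, and call two distinct points a, b adjacent if either (both a,b ∈ M or both a,b ∉ M) and a ∩ b = ∅, or (exactly one of a,b lies in M) and a ∩ b ≠ ∅. Call a tetrahedron any 4-element set of points that are pairwise adjacent. Then the number of tetrahedra containing the point {1,3} is exactly 11. -/

import Mathlib

/-- The points: the 28 two-element subsets of `{1, 2, …, 8}`. -/
def Pts : Finset (Finset ℕ) := (Finset.Icc 1 8).powersetCard 2

/-- The distinguished perfect matching `M = {{1,2},{3,4},{5,6},{7,8}}`. -/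
def M : Finset (Finset ℕ) := {{1, 2}, {3, 4}, {5, 6}, {7, 8}}

/-- Two distinct points `a, b` are adjacent if either both or neither lie in `M` and
`a ∩ b = ∅`, or exactly one of them lies in `M` and `a ∩ b ≠ ∅`. -/
def Adj (a b : Finset ℕ) : Prop :=
  a ≠ b ∧ (((a ∈ M ↔ b ∈ M) ∧ a ∩ b = ∅) ∨ (¬(a ∈ M ↔ b ∈ M) ∧ (a ∩ b).Nonempty))

instance : DecidableRel Adj := fun a b => by unfold Adj; infer_instance

/-- The neighbours of `{1, 3}`. -/
def nbrs : Finset (Finset ℕ) := Pts.filter (fun a => Adj {1, 3} a)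

theorem adj_symm' {a b : Finset ℕ} (h : Adj a b) : Adj b a := by
  unfold Adj at *
  rw [Finset.inter_comm b a, iff_comm (a := b ∈ M)]
  exact ⟨h.1.symm, h.2⟩

theorem p_mem : ({1, 3} : Finset ℕ) ∈ Pts := by decide +kernel

theorem small_count :
    ((nbrs.powersetCard 3).filter
      (fun T => ∀ a ∈ T, ∀ b ∈ T, a ≠ b → Adj a b)).card = 11 := by
  decide +kernel

/-- The number of tetrahedra (4-element sets of pairwise adjacent points) containing the
non-distinguished point `{1, 3}` is exactly 11. -/
theorem card_tetrahedra_through_nondistinguished_point :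
    ((Pts.powersetCard 4).filter
      (fun T => ({1, 3} : Finset ℕ) ∈ T ∧ ∀ a ∈ T, ∀ b ∈ T, a ≠ b → Adj a b)).card = 11 := by
  rw [← small_count]
  have hp := p_mem
  have hn : ∀ x, x ∈ nbrs ↔ x ∈ Pts ∧ Adj {1, 3} x := fun x => by simp [nbrs]
  generalize ({1, 3} : Finset ℕ) = p at *
  have hpn : p ∉ nbrs := fun h => ((hn p).1 h).2.1 rfl
  refine Finset.card_nbij' (fun T => T.erase p) (fun T => insert p T) ?_ ?_ ?_ ?_
  · intro T hT
    simp only [Finset.coe_filter, Finset.mem_powersetCard, Set.mem_ofPred_eq] at hT ⊢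
    obtain ⟨⟨hs, hc⟩, hpT, hadj⟩ := hT
    refine ⟨⟨?_, by rw [Finset.card_erase_of_mem hpT, hc]⟩, ?_⟩
    · intro x hx
      obtain ⟨h1, h2⟩ := Finset.mem_erase.1 hx
      exact (hn x).2 ⟨hs h2, hadj p hpT x h2 h1.symm⟩
    · intro a ha b hb
      exact hadj a (Finset.mem_of_mem_erase ha) b (Finset.mem_of_mem_erase hb)
  · intro T hT
    simp only [Finset.coe_filter, Finset.mem_powersetCard, Set.mem_ofPred_eq] at hT ⊢
    obtain ⟨⟨hs, hc⟩, hadj⟩ := hT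
    have hpT : p ∉ T := fun h => hpn (hs h)
    refine ⟨⟨?_, by rw [Finset.card_insert_of_notMem hpT, hc]⟩, Finset.mem_insert_self _ _, ?_⟩
    · intro x hx
      rcases Finset.mem_insert.1 hx with rfl | h
      · exact hp
      · exact ((hn x).1 (hs h)).1
    · intro a ha b hb hab
      rcases Finset.mem_insert.1 ha with rfl | ha'
      · rcases Finset.mem_insert.1 hb with rfl | hb
        · exact absurd rfl hab
        · exact ((hn b).1 (hs hb)).2
      · rcases Finset.mem_insert.1 hb with rfl | hb
        · exact adj_symm' ((hn a).1 (hs ha')).2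
        · exact hadj a ha' b hb hab
  · intro T hT
    simp only [Finset.coe_filter, Set.mem_ofPred_eq] at hT
    exact Finset.insert_erase hT.2.1
  · intro T hT
    simp only [Finset.coe_filter, Finset.mem_powersetCard, Set.mem_ofPred_eq] at hT
    exact Finset.erase_insert fun h => hpn (hT.1.1 h)
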